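/- arXiv:2306.09515 — 2 statements merged into one kernel-verified Lean document; each statement's English description precedes it below -/
import Mathlib

section
/- Let v = (v₁, v₂) be a smooth solution of the 2D Euler equations on the half-plane {x₁ ≤ 0} × (-∞,0] of the self-similar form v(x,t) = (1−t)^{−α} V(x/(1−t)^{1−α}) with α ∈ (0,1), where V is C^{2,γ}, |V(y)| ≤ C(1+|y|)^δ for some δ < 1 (sublinear), |∇V| bounded, the vorticity ω = ∂₂v₁ − ∂₁v₂ is bounded, v₁ = 0 on the boundary {x₁ = 0}, and the second component of V is odd in the second variable. Then v ≡ 0. -/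
open Set

lemma curl_zero (F : ℝ × ℝ → ℝ × ℝ) (hF : ContDiff ℝ 1 F) (q : ℝ × ℝ → ℝ)
    (h : ∀ x : ℝ × ℝ, x.1 < 0 → F x = (fderiv ℝ q x (1,0), fderiv ℝ q x (0,1))) :
    ∀ x : ℝ × ℝ, x.1 ≤ 0 → (fderiv ℝ F x (0,1)).1 = (fderiv ℝ F x (1,0)).2 := by
  have hd : Differentiable ℝ F := hF.differentiable (by norm_num)
  have hc : Continuous (fderiv ℝ F) := hF.continuous_fderiv (by norm_num)
  have hS : IsClosed {x : ℝ × ℝ | (fderiv ℝ F x (0,1)).1 = (fderiv ℝ F x (1,0)).2} :=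
    isClosed_eq (continuous_fst.comp (hc.clm_apply continuous_const))
      (continuous_snd.comp (hc.clm_apply continuous_const))
  have hH : IsOpen {x : ℝ × ℝ | x.1 < 0} := isOpen_lt continuous_fst continuous_const
  have hU : IsOpen {x : ℝ × ℝ | x.1 < 0 ∧ F x ≠ 0} :=
    hH.inter (isOpen_ne_fun hd.continuous continuous_const)
  have h1 : {x : ℝ × ℝ | x.1 < 0 ∧ F x ≠ 0} ⊆
      {x : ℝ × ℝ | (fderiv ℝ F x (0,1)).1 = (fderiv ℝ F x (1,0)).2} := by
    intro x hx
    let T : ℝ × ℝ →L[ℝ] (ℝ × ℝ →L[ℝ] ℝ) :=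
      (ContinuousLinearMap.fst ℝ ℝ ℝ).smulRight (ContinuousLinearMap.fst ℝ ℝ ℝ) +
      (ContinuousLinearMap.snd ℝ ℝ ℝ).smulRight (ContinuousLinearMap.snd ℝ ℝ ℝ)
    have hq : ∀ᶠ y in nhds x, HasFDerivAt q (T (F y)) y := by
      filter_upwards [hU.mem_nhds hx] with y hy
      have hdq : DifferentiableAt ℝ q y := by
        by_contra hn
        apply hy.2
        rw [h y hy.1, fderiv_zero_of_not_differentiableAt hn]
        simp
      have : T (F y) = fderiv ℝ q y := by
        rw [h y hy.1]
        ext <;> simp [T]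
      rw [this]
      exact hdq.hasFDerivAt
    have h2 : HasFDerivAt (fun y => T (F y)) (T.comp (fderiv ℝ F x)) x :=
      T.hasFDerivAt.comp x (hd x).hasFDerivAt
    have := second_derivative_symmetric_of_eventually hq h2 (0,1) (1,0)
    simpa [T] using this
  have h2 : {x : ℝ × ℝ | x.1 < 0} ⊆
      {x : ℝ × ℝ | (fderiv ℝ F x (0,1)).1 = (fderiv ℝ F x (1,0)).2} := by
    intro x hx
    by_cases hxc : x ∈ closure {x : ℝ × ℝ | x.1 < 0 ∧ F x ≠ 0}
    · exact closure_minimal h1 hS hxc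
    · have : F =ᶠ[nhds x] fun _ => 0 := by
        filter_upwards [hH.mem_nhds hx, isClosed_closure.isOpen_compl.mem_nhds hxc] with y hy hy2
        by_contra hn
        exact hy2 (subset_closure ⟨hy, hn⟩)
      have := this.fderiv_eq (𝕜 := ℝ)
      simp [this]
  intro x hx
  apply closure_minimal h2 hS
  rcases x with ⟨a, c⟩
  have : Filter.Tendsto (fun s : ℝ => ((a - s, c) : ℝ × ℝ)) (nhdsWithin 0 (Ioi 0)) (nhds (a, c)) := by
    have : Continuous (fun s : ℝ => ((a - s, c) : ℝ × ℝ)) := by fun_prop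
    have h := this.tendsto 0
    simp only [sub_zero] at h
    exact h.mono_left nhdsWithin_le_nhds
  refine mem_closure_of_tendsto this ?_
  filter_upwards [self_mem_nhdsWithin] with s hs
  simp only [mem_Ioi] at hs
  simp only at hx ⊢
  linarith

lemma max_pr (W : ℝ × ℝ → ℝ) (hW : ContDiff ℝ 1 W) (b : ℝ × ℝ → ℝ × ℝ) (K M : ℝ)
    (hb : ∀ y, ‖b y‖ ≤ K * (1 + ‖y‖)) (hb0 : ∀ y : ℝ × ℝ, y.1 = 0 → (b y).1 = 0)
    (hM : ∀ y : ℝ × ℝ, y.1 ≤ 0 → |W y| ≤ M)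
    (hE : ∀ y : ℝ × ℝ, y.1 ≤ 0 → W y + fderiv ℝ W y (b y) = 0) :
    ∀ y : ℝ × ℝ, y.1 ≤ 0 → W y = 0 := by
  have hd : Differentiable ℝ W := hW.differentiable (by norm_num)
  have hK : 0 ≤ K := by
    have := hb 0
    simp at this
    exact (norm_nonneg _).trans this
  have key : ∀ ε > 0, ∀ y : ℝ × ℝ, y.1 ≤ 0 →
      W y ^ 2 ≤ ε * (4 * K + Real.log (1 + y.1^2 + y.2^2)) := by
    intro ε hε y0 hy0
    let φ : ℝ × ℝ → ℝ := fun y => W y ^ 2 - ε * Real.log (1 + y.1^2 + y.2^2)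
    have hpos : ∀ y : ℝ × ℝ, 0 < 1 + y.1^2 + y.2^2 := fun y => by positivity
    have hφc : Continuous φ := by
      have : Continuous fun y : ℝ × ℝ => Real.log (1 + y.1^2 + y.2^2) :=
        Continuous.log (by fun_prop) (fun y => (hpos y).ne')
      have := hd.continuous
      fun_prop
    have hHc : IsClosed {x : ℝ × ℝ | x.1 ≤ 0} := isClosed_le continuous_fst continuous_const
    obtain ⟨y, hy, hmax⟩ : ∃ y ∈ {x : ℝ × ℝ | x.1 ≤ 0}, IsMaxOn φ {x : ℝ × ℝ | x.1 ≤ 0} y := by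
      refine hφc.continuousOn.exists_isMaxOn' hHc hy0 ?_
      have ht : Filter.Tendsto (fun y : ℝ × ℝ => ε * Real.log (1 + y.1^2 + y.2^2))
          (Filter.cocompact (ℝ × ℝ)) Filter.atTop := by
        apply Filter.Tendsto.const_mul_atTop hε
        apply Real.tendsto_log_atTop.comp
        refine Filter.tendsto_atTop_mono (f := fun y : ℝ × ℝ => ‖y‖) ?_ tendsto_norm_cocompact_atTop
        intro y
        rw [Prod.norm_def, Real.norm_eq_abs, Real.norm_eq_abs]
        apply max_le
        · nlinarith [sq_abs y.1, sq_nonneg (|y.1| - 1), sq_nonneg y.2]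
        · nlinarith [sq_abs y.2, sq_nonneg (|y.2| - 1), sq_nonneg y.1]
      have h1 := (ht.eventually_ge_atTop (M^2 - φ y0))
      rw [Filter.eventually_inf_principal]
      filter_upwards [h1] with y hy hyH
      have : W y ^ 2 ≤ M ^ 2 := by
        rw [← sq_abs]
        exact pow_le_pow_left₀ (abs_nonneg _) (hM y hyH) 2
      simp only [φ] at hy ⊢
      linarith
    simp only [mem_ofPred_eq] at hy
    have hloc : IsLocalMax (fun s : ℝ => φ (y + s • b y)) 0 := by
      have : ∀ᶠ s : ℝ in nhds 0, (y + s • b y).1 ≤ 0 := by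
        rcases hy.lt_or_eq with h | h
        · have hc : Continuous fun s : ℝ => (y + s • b y).1 := by fun_prop
          have := hc.tendsto 0
          simp only [zero_smul, add_zero] at this
          filter_upwards [this.eventually_lt_const h] with s hs using hs.le
        · refine Filter.Eventually.of_forall fun s => ?_
          simp [h, hb0 y h]
      filter_upwards [this] with s hs
      simpa using hmax hs
    have hl : HasDerivAt (fun s : ℝ => y + s • b y) (b y) 0 := by
      simpa using ((hasDerivAt_id (0:ℝ)).smul_const (b y)).const_add y
    have hWd : HasDerivAt (fun s : ℝ => W (y + s • b y)) (fderiv ℝ W y (b y)) 0 := by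
      have := (hd (y + (0:ℝ) • b y)).hasFDerivAt.comp_hasDerivAt (0:ℝ) hl
      simp only [zero_smul, add_zero] at this
      exact this
    have h1 : HasDerivAt (fun s : ℝ => (y + s • b y).1) (b y).1 0 := by
      simpa using ((hasDerivAt_id (0:ℝ)).mul_const (b y).1).const_add y.1
    have h2 : HasDerivAt (fun s : ℝ => (y + s • b y).2) (b y).2 0 := by
      simpa using ((hasDerivAt_id (0:ℝ)).mul_const (b y).2).const_add y.2
    have hLd := (((h1.pow 2).const_add 1).add (h2.pow 2)).log (by simpa using (hpos y).ne')
    have hφd := (hWd.pow 2).sub (hLd.const_mul ε)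
    have h0 := hloc.hasDerivAt_eq_zero hφd
    simp at h0
    have hEy := hE y hy
    have hWy : fderiv ℝ W y (b y) = - W y := by linarith
    rw [hWy] at h0
    have hfin : W y ^ 2 ≤ ε * (4 * K) := by
      have hq : -(2 * y.1 * (b y).1 + 2 * y.2 * (b y).2) / (1 + y.1^2 + y.2^2) ≤ 8 * K := by
        rw [div_le_iff₀ (hpos y)]
        have hbb := hb y
        have e1 : |(b y).1| ≤ ‖b y‖ := norm_fst_le (b y)
        have e2 : |(b y).2| ≤ ‖b y‖ := norm_snd_le (b y)
        have f1 : |y.1| ≤ ‖y‖ := norm_fst_le y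
        have f2 : |y.2| ≤ ‖y‖ := norm_snd_le y
        have g : ‖y‖^2 ≤ y.1^2 + y.2^2 := by
          rw [Prod.norm_def, Real.norm_eq_abs, Real.norm_eq_abs]
          rcases max_choice |y.1| |y.2| with h | h <;> rw [h, sq_abs] <;> nlinarith [sq_nonneg y.1, sq_nonneg y.2]
        have n0 := norm_nonneg y
        have k1 : |y.1 * (b y).1| ≤ ‖y‖ * (K * (1 + ‖y‖)) := by
          rw [abs_mul]; exact mul_le_mul f1 (e1.trans hbb) (abs_nonneg _) n0
        have k2 : |y.2 * (b y).2| ≤ ‖y‖ * (K * (1 + ‖y‖)) := by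
          rw [abs_mul]; exact mul_le_mul f2 (e2.trans hbb) (abs_nonneg _) n0
        have k3 : ‖y‖ * (K * (1 + ‖y‖)) ≤ K * (2 * (1 + y.1^2 + y.2^2)) := by
          have : ‖y‖ * (1 + ‖y‖) ≤ 2 * (1 + y.1^2 + y.2^2) := by nlinarith [sq_nonneg (‖y‖ - 1)]
          calc _ = K * (‖y‖ * (1 + ‖y‖)) := by ring
            _ ≤ _ := mul_le_mul_of_nonneg_left this hK
        linarith [(abs_le.1 k1).1, (abs_le.1 k2).1]
      have := mul_le_mul_of_nonneg_left hq hε.le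
      rw [neg_div] at this
      nlinarith
    have hc := hmax hy0
    have hlog : 0 ≤ Real.log (1 + y.1^2 + y.2^2) :=
      Real.log_nonneg (by nlinarith [sq_nonneg y.1, sq_nonneg y.2])
    simp only [φ, mem_ofPred_eq] at hc
    nlinarith [mul_nonneg hε.le hlog]
  intro y hy
  have hlim : Filter.Tendsto (fun ε : ℝ => ε * (4 * K + Real.log (1 + y.1^2 + y.2^2)))
      (nhdsWithin 0 (Ioi 0)) (nhds 0) := by
    have : Continuous fun ε : ℝ => ε * (4 * K + Real.log (1 + y.1^2 + y.2^2)) := by fun_prop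
    have h := this.tendsto 0
    simp only [zero_mul] at h
    exact h.mono_left nhdsWithin_le_nhds
  have : W y ^ 2 ≤ 0 := by
    refine ge_of_tendsto hlim ?_
    filter_upwards [self_mem_nhdsWithin] with ε hε using key ε hε y hy
  nlinarith [sq_nonneg (W y), pow_eq_zero_iff (two_ne_zero) |>.1 (le_antisymm this (sq_nonneg (W y)))]

lemma curl_comp (α : ℝ) (V : ℝ × ℝ → ℝ × ℝ) (hV : ContDiff ℝ 2 V) (y : ℝ × ℝ)
    (hdiv : (fderiv ℝ V y (1,0)).1 + (fderiv ℝ V y (0,1)).2 = 0)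
    (hcurl : (fderiv ℝ (fun y => α • V y + fderiv ℝ V y ((1 - α) • y + V y)) y (0,1)).1
      = (fderiv ℝ (fun y => α • V y + fderiv ℝ V y ((1 - α) • y + V y)) y (1,0)).2) :
    ((fderiv ℝ V y (0,1)).1 - (fderiv ℝ V y (1,0)).2) +
      fderiv ℝ (fun y => (fderiv ℝ V y (0,1)).1 - (fderiv ℝ V y (1,0)).2) y
        ((1 - α) • y + V y) = 0 := by
  have hd : Differentiable ℝ V := hV.differentiable (by norm_num)
  have hd1 : Differentiable ℝ (fderiv ℝ V) :=
    (hV.fderiv_right (m := 1) (by norm_num)).differentiable (by norm_num)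
  have hsymm : ∀ a c, fderiv ℝ (fderiv ℝ V) y a c = fderiv ℝ (fderiv ℝ V) y c a := by
    intro a c
    exact second_derivative_symmetric (fun z => (hd z).hasFDerivAt) (hd1 y).hasFDerivAt a c
  have hVd := (hd y).hasFDerivAt
  have hDV := (hd1 y).hasFDerivAt
  have hb : HasFDerivAt (fun y => (1 - α) • y + V y)
      ((1 - α) • ContinuousLinearMap.id ℝ (ℝ × ℝ) + fderiv ℝ V y) y :=
    ((hasFDerivAt_id y).const_smul (1 - α)).add hVd
  have hG := (hVd.const_smul α).add (hDV.clm_apply hb)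
  have hWd : HasFDerivAt (fun y => (fderiv ℝ V y (0,1)).1 - (fderiv ℝ V y (1,0)).2) _ y :=
    ((hDV.clm_apply (hasFDerivAt_const ((0,1) : ℝ × ℝ) y)).fst).sub
      ((hDV.clm_apply (hasFDerivAt_const ((1,0) : ℝ × ℝ) y)).snd)
  have hG' : fderiv ℝ (fun y => α • V y + fderiv ℝ V y ((1 - α) • y + V y)) y = _ := hG.fderiv
  rw [hG'] at hcurl
  rw [hWd.fderiv]
  simp only [_root_.add_apply, ContinuousLinearMap.comp_apply,
    ContinuousLinearMap.flip_apply, _root_.smul_apply, _root_.sub_apply,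
    ContinuousLinearMap.id_apply, ContinuousLinearMap.coe_fst', ContinuousLinearMap.coe_snd',
    zero_add, Prod.fst_add, Prod.snd_add, Prod.smul_fst, 
    Prod.smul_snd, map_add, map_smul, smul_eq_mul, ContinuousLinearMap.comp_zero] at hcurl ⊢
  rw [hsymm (0,1) y, hsymm (1,0) y, hsymm (0,1) (V y), hsymm (1,0) (V y)] at hcurl
  have hdec : ∀ z : ℝ × ℝ, fderiv ℝ V y z = z.1 • fderiv ℝ V y (1,0) + z.2 • fderiv ℝ V y (0,1) := by
    intro z
    rw [← map_smul, ← map_smul, ← map_add]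
    congr 1
    ext <;> simp
  rw [hdec (fderiv ℝ V y (0,1)), hdec (fderiv ℝ V y (1,0))] at hcurl
  simp only [Prod.fst_add, Prod.snd_add, Prod.smul_fst, Prod.smul_snd, smul_eq_mul] at hcurl
  generalize fderiv ℝ V y (0,1) = A at *
  generalize fderiv ℝ V y (1,0) = B at *
  linear_combination hcurl - (A.1 - B.2) * hdiv

lemma liouville_half (V : ℝ × ℝ → ℝ × ℝ) (hd : Differentiable ℝ V)
    (C δ : ℝ) (hδ : δ < 1) (hC : ∀ y : ℝ × ℝ, ‖V y‖ ≤ C * (1 + ‖y‖) ^ δ)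
    (hdiv : ∀ y : ℝ × ℝ, y.1 ≤ 0 → (fderiv ℝ V y (1,0)).1 + (fderiv ℝ V y (0,1)).2 = 0)
    (hcurl : ∀ y : ℝ × ℝ, y.1 ≤ 0 → (fderiv ℝ V y (0,1)).1 - (fderiv ℝ V y (1,0)).2 = 0)
    (hbc : ∀ x₂ : ℝ, (V (0, x₂)).1 = 0) (y : ℝ × ℝ) (hy : y.1 ≤ 0) : V y = V 0 := by
  let f : ℂ → ℂ := fun z => ⟨(V (z.re, z.im)).1, -(V (z.re, z.im)).2⟩
  let f' : ℂ → ℂ := fun z => ⟨(fderiv ℝ V (z.re, z.im) (1,0)).1, -(fderiv ℝ V (z.re, z.im) (1,0)).2⟩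
  have hf : ∀ z : ℂ, z.re ≤ 0 → HasDerivAt f (f' z) z := by
    intro z hz
    have hp : HasFDerivAt (fun z : ℂ => (z.re, z.im)) (Complex.reCLM.prod Complex.imCLM) z :=
      (Complex.reCLM.prod Complex.imCLM).hasFDerivAt
    have h1 : HasFDerivAt (fun z : ℂ => V (z.re, z.im)) _ z :=
      (hd (z.re, z.im)).hasFDerivAt.comp z hp
    let T : ℝ × ℝ →L[ℝ] ℂ := (Complex.ofRealCLM.comp (ContinuousLinearMap.fst ℝ ℝ ℝ)) -
      Complex.I • (Complex.ofRealCLM.comp (ContinuousLinearMap.snd ℝ ℝ ℝ))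
    have h2 : HasFDerivAt (fun z : ℂ => T (V (z.re, z.im))) _ z := T.hasFDerivAt.comp z h1
    have h3 : (fun z : ℂ => T (V (z.re, z.im))) = f := by
      funext w
      apply Complex.ext <;> simp [T, f]
    rw [h3] at h2
    have hdec : ∀ a c : ℝ, fderiv ℝ V (z.re, z.im) (a, c) =
        a • fderiv ℝ V (z.re, z.im) (1,0) + c • fderiv ℝ V (z.re, z.im) (0,1) := by
      intro a c
      rw [← map_smul, ← map_smul, ← map_add]
      congr 1
      ext <;> simp
    have e1 := hdiv (z.re, z.im) hz
    have e2 := hcurl (z.re, z.im) hz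
    rw [hasDerivAt_iff_hasFDerivAt]
    refine hasFDerivAt_of_restrictScalars ℝ h2 ?_
    ext w
    simp only [ContinuousLinearMap.coe_restrictScalars', ContinuousLinearMap.comp_apply, ContinuousLinearMap.prod_apply, Complex.reCLM_apply, Complex.imCLM_apply, hdec w.re w.im]
    generalize fderiv ℝ V (z.re, z.im) (0,1) = A at *
    apply Complex.ext
    · simp [T, f']
      left
      linarith
    · simp [T, f']
      linear_combination (w.im) * e1
  have hre : ∀ z : ℂ, z.re = 0 → (f' z).im = 0 := by
    intro z hz
    have h1 : HasDerivAt (fun s : ℝ => (V (0, s)).1) (fderiv ℝ V (0, z.im) (0,1)).1 z.im := by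
      have hl : HasDerivAt (fun s : ℝ => ((0, s) : ℝ × ℝ)) (0, 1) z.im :=
        (hasDerivAt_const _ _).prodMk (hasDerivAt_id _)
      have := (hd (0, z.im)).hasFDerivAt.comp_hasDerivAt z.im hl
      exact (hasFDerivAt_fst (𝕜 := ℝ)).comp_hasDerivAt z.im this
    have h2 : (fun s : ℝ => (V (0, s)).1) = fun _ => 0 := funext hbc
    rw [h2] at h1
    have h3 := h1.unique (hasDerivAt_const _ _)
    have h4 := hcurl (0, z.im) le_rfl
    simp only [f', hz]
    linarith
  have hrf : ∀ z : ℂ, z.re = 0 → (f z).re = 0 := by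
    intro z hz
    simp only [f, hz, hbc]
  let r : ℂ → ℂ := fun z => -(starRingEnd ℂ z)
  let h : ℂ → ℂ := fun z => -(starRingEnd ℂ (f (r z)))
  have hh : ∀ z : ℂ, 0 ≤ z.re → HasDerivAt h (starRingEnd ℂ (f' (r z))) z := by
    intro z hz
    have h0 : (r z).re ≤ 0 := by simpa [r] using hz
    have hneg : HasDerivAt (fun w => f (-w)) (-(f' (r z))) (starRingEnd ℂ z) := by
      have := (hf _ h0).scomp (starRingEnd ℂ z) (hasDerivAt_neg (starRingEnd ℂ z))
      simpa [Function.comp_def] using this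
    have := hneg.conj_conj.neg
    have hval : -(starRingEnd ℂ (-(f' (r z)))) = starRingEnd ℂ (f' (r z)) := by simp
    rw [hval, Complex.conj_conj] at this
    exact this
  let g : ℂ → ℂ := fun z => if z.re ≤ 0 then f z else h z
  have hgl : ∀ z : ℂ, z.re ≤ 0 → g z = f z := fun z hz => if_pos hz
  have hgr : ∀ z : ℂ, 0 ≤ z.re → g z = h z := by
    intro z hz
    rcases hz.lt_or_eq with h1 | h1
    · exact if_neg (not_le.2 h1)
    · rw [hgl z h1.symm.le]
      have hr : r z = z := by apply Complex.ext <;> simp [r, ← h1]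
      simp only [h, hr]
      apply Complex.ext <;> simp [hrf z h1.symm]
  have hg : Differentiable ℂ g := by
    intro z
    rcases lt_trichotomy z.re 0 with hz | hz | hz
    · have : g =ᶠ[nhds z] f := by
        filter_upwards [(isOpen_lt Complex.continuous_re continuous_const).mem_nhds hz] with w hw
        exact hgl w (le_of_lt hw)
      exact ((hf z hz.le).congr_of_eventuallyEq this).differentiableAt
    · have a1 : HasDerivWithinAt g (f' z) {w | w.re ≤ 0} z :=
        (hf z hz.le).hasDerivWithinAt.congr (fun w hw => hgl w hw) (hgl z hz.le)
      have a2 : HasDerivWithinAt g (f' z) {w | 0 ≤ w.re} z := by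
        have hr : r z = z := by apply Complex.ext <;> simp [r, hz]
        have hc : starRingEnd ℂ (f' (r z)) = f' z := by
          rw [hr]; exact Complex.conj_eq_iff_im.2 (hre z hz)
        have := (hh z hz.symm.le)
        rw [hc] at this
        exact this.hasDerivWithinAt.congr (fun w hw => hgr w hw) (hgr z hz.symm.le)
      have a3 := a1.union a2
      have : {w : ℂ | w.re ≤ 0} ∪ {w | 0 ≤ w.re} = univ := by
        ext w; simp [le_total]
      rw [this, hasDerivWithinAt_univ] at a3
      exact a3.differentiableAt
    · have : g =ᶠ[nhds z] h := by
        filter_upwards [(isOpen_lt continuous_const Complex.continuous_re).mem_nhds hz] with w hw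
        exact hgr w (le_of_lt hw)
      exact ((hh z hz.le).congr_of_eventuallyEq this).differentiableAt
  have hC0 : 0 ≤ C := by
    have := hC 0
    simp at this
    exact (norm_nonneg _).trans this
  let δ' := max δ 0
  have hδ' : δ' < 1 := max_lt hδ one_pos
  have hfb : ∀ z : ℂ, ‖f z‖ ≤ 2 * C * (1 + ‖z‖) ^ δ' := by
    intro z
    have h1 := hC (z.re, z.im)
    have h2 : ‖((z.re, z.im) : ℝ × ℝ)‖ ≤ ‖z‖ :=
      max_le (Complex.abs_re_le_norm z) (Complex.abs_im_le_norm z)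
    have h3 : (1 + ‖((z.re, z.im) : ℝ × ℝ)‖) ^ δ ≤ (1 + ‖z‖) ^ δ' := by
      calc _ ≤ (1 + ‖((z.re, z.im) : ℝ × ℝ)‖) ^ δ' :=
            Real.rpow_le_rpow_of_exponent_le (by linarith [norm_nonneg ((z.re, z.im) : ℝ × ℝ)]) (le_max_left _ _)
        _ ≤ _ := Real.rpow_le_rpow (by positivity) (by linarith) (le_max_right _ _)
    have h4 := Complex.norm_le_abs_re_add_abs_im (f z)
    have h5 : |(f z).re| ≤ ‖V (z.re, z.im)‖ := norm_fst_le (V (z.re, z.im))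
    have h6 : |(f z).im| ≤ ‖V (z.re, z.im)‖ := by
      simp only [f, abs_neg]
      exact norm_snd_le (V (z.re, z.im))
    have h7 := mul_le_mul_of_nonneg_left h3 hC0
    linarith
  have hgb : ∀ z : ℂ, ‖g z‖ ≤ 2 * C * (1 + ‖z‖) ^ δ' := by
    intro z
    by_cases hz : z.re ≤ 0
    · rw [hgl z hz]; exact hfb z
    · rw [hgr z (not_le.1 hz).le]
      have := hfb (r z)
      simpa [h, r] using this
  have hg0 : ∀ z, deriv g z = 0 := by
    intro z
    have hlim : Filter.Tendsto (fun R : ℝ => 2 * C * (1 + ‖z‖ + R) ^ δ' / R) Filter.atTop (nhds 0) := by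
      have t1 : Filter.Tendsto (fun R : ℝ => (2 * C * 2 ^ δ') * R ^ (-(1 - δ'))) Filter.atTop (nhds 0) := by
        simpa using (tendsto_rpow_neg_atTop (sub_pos.2 hδ')).const_mul (2 * C * 2 ^ δ')
      refine squeeze_zero' ?_ ?_ t1
      · filter_upwards [Filter.eventually_gt_atTop 0] with R hR
        positivity
      · filter_upwards [Filter.eventually_gt_atTop (1 + ‖z‖)] with R hR
        have hR0 : 0 < R := by linarith [norm_nonneg z]
        have : (1 + ‖z‖ + R) ^ δ' ≤ (2 * R) ^ δ' :=
          Real.rpow_le_rpow (by positivity) (by linarith) (le_max_right _ _)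
        rw [Real.mul_rpow (by norm_num) hR0.le] at this
        rw [neg_sub, Real.rpow_sub hR0, Real.rpow_one]
        calc _ ≤ 2 * C * (2 ^ δ' * R ^ δ') / R := by gcongr
          _ = _ := by ring
    have : ‖deriv g z‖ ≤ 0 := by
      refine ge_of_tendsto hlim ?_
      filter_upwards [Filter.eventually_gt_atTop 0] with R hR
      refine Complex.norm_deriv_le_of_forall_mem_sphere_norm_le hR hg.diffContOnCl ?_
      intro w hw
      refine (hgb w).trans ?_
      have hw' : ‖w‖ ≤ ‖z‖ + R := by
        have h1 : ‖w - z‖ = R := by simpa [dist_eq_norm] using hw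
        have := norm_le_norm_add_norm_sub' w z
        linarith
      have : (1 + ‖w‖) ^ δ' ≤ (1 + ‖z‖ + R) ^ δ' :=
        Real.rpow_le_rpow (by positivity) (by linarith) (le_max_right _ _)
      gcongr
    simpa using this
  have hconst := is_const_of_deriv_eq_zero hg hg0 ⟨y.1, y.2⟩ 0
  rw [hgl _ hy, hgl 0 le_rfl] at hconst
  have q1 := congrArg Complex.re hconst
  have q2 := congrArg Complex.im hconst
  simp only [f, Complex.zero_re, Complex.zero_im] at q1 q2
  ext
  · exact q1
  · have := neg_injective q2
    exact this



/-- A smooth self-similar solution `v(x,t) = (1−t)^{−α} V(x/(1−t)^{1−α})` of the 2D Euler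
equations on the half-plane `{x₁ ≤ 0}`, with `V` of class `C²`, sublinear, `∇V` bounded,
bounded vorticity, no-penetration boundary condition, and second component of `V` odd in
the second variable, vanishes identically. -/
theorem stmt_15
    (α : ℝ) (hα : α ∈ Ioo (0:ℝ) 1)
    (V : ℝ × ℝ → ℝ × ℝ) (hV : ContDiff ℝ 2 V)
    -- sublinear growth of V
    (hVsub : ∃ C : ℝ, ∃ δ < (1:ℝ), ∀ y : ℝ × ℝ, ‖V y‖ ≤ C * (1 + ‖y‖) ^ δ)
    -- bounded gradient of V
    (hVgrad : ∃ C : ℝ, ∀ y : ℝ × ℝ, ‖fderiv ℝ V y‖ ≤ C)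
    -- second component of V is odd in the second variable
    (hVodd : ∀ y : ℝ × ℝ, (V (y.1, -y.2)).2 = -(V y).2)
    (v : ℝ × ℝ → ℝ → ℝ × ℝ)
    -- self-similar form of the solution
    (hv : ∀ x : ℝ × ℝ, ∀ t ≤ (0:ℝ),
      v x t = ((1:ℝ) - t) ^ (-α) • V ((((1:ℝ) - t) ^ (1 - α))⁻¹ • x))
    -- v solves the 2D Euler equations on the half-plane {x₁ ≤ 0} for t ≤ 0
    (p : ℝ × ℝ → ℝ → ℝ)
    (heuler : ∀ x : ℝ × ℝ, x.1 ≤ 0 → ∀ t ≤ (0:ℝ),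
      deriv (fun s => v x s) t + fderiv ℝ (fun y => v y t) x (v x t)
        + (fderiv ℝ (fun y => p y t) x (1, 0), fderiv ℝ (fun y => p y t) x (0, 1)) = 0)
    (hdiv : ∀ x : ℝ × ℝ, x.1 ≤ 0 → ∀ t ≤ (0:ℝ),
      fderiv ℝ (fun y => (v y t).1) x (1, 0) + fderiv ℝ (fun y => (v y t).2) x (0, 1) = 0)
    -- bounded vorticity `ω = ∂₂v₁ − ∂₁v₂`
    (hω_bdd : ∃ M : ℝ, ∀ x : ℝ × ℝ, x.1 ≤ 0 → ∀ t ≤ (0:ℝ),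
      |fderiv ℝ (fun y => (v y t).1) x (0, 1) - fderiv ℝ (fun y => (v y t).2) x (1, 0)| ≤ M)
    -- no-penetration boundary condition `v₁ = 0` on `{x₁ = 0}`
    (hbc : ∀ x₂ : ℝ, ∀ t ≤ (0:ℝ), (v (0, x₂) t).1 = 0) :
    ∀ x : ℝ × ℝ, x.1 ≤ 0 → ∀ t ≤ (0:ℝ), v x t = 0 := by
  have hd : Differentiable ℝ V := hV.differentiable (by norm_num)
  have hC1 : ContDiff ℝ 1 (fderiv ℝ V) := hV.fderiv_right (by norm_num)
  have hv0 : ∀ y, v y 0 = V y := by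
    intro y
    rw [hv y 0 le_rfl]
    simp
  have hfst : ∀ x w, fderiv ℝ (fun y => (V y).1) x w = (fderiv ℝ V x w).1 := by
    intro x w
    rw [((hd x).hasFDerivAt.fst).fderiv]
    rfl
  have hsnd : ∀ x w, fderiv ℝ (fun y => (V y).2) x w = (fderiv ℝ V x w).2 := by
    intro x w
    rw [((hd x).hasFDerivAt.snd).fderiv]
    rfl
  have hdivV : ∀ y : ℝ × ℝ, y.1 ≤ 0 → (fderiv ℝ V y (1,0)).1 + (fderiv ℝ V y (0,1)).2 = 0 := by
    intro y hy
    have := hdiv y hy 0 le_rfl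
    simp only [hv0, hfst, hsnd] at this
    exact this
  have hbcV : ∀ x₂ : ℝ, (V (0, x₂)).1 = 0 := by
    intro x₂
    have := hbc x₂ 0 le_rfl
    rwa [hv0] at this
  obtain ⟨C, δ, hδ, hC⟩ := hVsub
  obtain ⟨M, hM⟩ := hω_bdd
  obtain ⟨L, hL⟩ := hVgrad
  have hMV : ∀ y : ℝ × ℝ, y.1 ≤ 0 → |(fderiv ℝ V y (0,1)).1 - (fderiv ℝ V y (1,0)).2| ≤ M := by
    intro y hy
    have := hM y hy 0 le_rfl
    simp only [hv0, hfst, hsnd] at this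
    exact this
  let G : ℝ × ℝ → ℝ × ℝ := fun y => α • V y + fderiv ℝ V y ((1 - α) • y + V y)
  have hGC : ContDiff ℝ 1 G := by
    have hV1 : ContDiff ℝ 1 V := hV.of_le (by norm_num)
    exact (hV1.const_smul α).add (hC1.clm_apply ((contDiff_id.const_smul (1 - α)).add hV1))
  -- the profile equation, at time t = -1
  let ν : ℝ := ((2:ℝ) ^ (1 - α))⁻¹
  have hν : 0 < ν := by positivity
  let k : ℝ := (2:ℝ) ^ (-α - 1)
  have hk : 0 < k := by positivity
  have hprof : ∀ x : ℝ × ℝ, deriv (fun s => v x s) (-1) + fderiv ℝ (fun y => v y (-1)) x (v x (-1))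
      = k • G (ν • x) := by
    intro x
    have hvm : ∀ y, v y (-1) = (2:ℝ) ^ (-α) • V (ν • y) := by
      intro y
      rw [hv y (-1) (by norm_num)]
      norm_num [ν]
    have hlin : HasFDerivAt (fun y : ℝ × ℝ => ν • y) (ν • ContinuousLinearMap.id ℝ (ℝ × ℝ)) x :=
      (hasFDerivAt_id x).const_smul ν
    have hsp : HasFDerivAt (fun y => (2:ℝ) ^ (-α) • V (ν • y)) _ x :=
      ((hd (ν • x)).hasFDerivAt.comp x hlin).const_smul ((2:ℝ) ^ (-α))
    have e1 : fderiv ℝ (fun y => v y (-1)) x (v x (-1)) = k • fderiv ℝ V (ν • x) (V (ν • x)) := by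
      have : (fun y => v y (-1)) = fun y => (2:ℝ) ^ (-α) • V (ν • y) := funext hvm
      rw [this, hsp.fderiv, hvm]
      simp only [_root_.smul_apply, ContinuousLinearMap.comp_apply, ContinuousLinearMap.id_apply, map_smul, smul_smul]
      congr 1
      simp only [ν, k]
      rw [← Real.rpow_neg (by norm_num), ← Real.rpow_add (by norm_num), ← Real.rpow_add (by norm_num)]
      congr 1
      ring
    have hs : HasDerivAt (fun s : ℝ => 1 - s) (-1) (-1) := by
      simpa using (hasDerivAt_id (-1:ℝ)).const_sub 1
    have r1 : HasDerivAt (fun s : ℝ => (1 - s) ^ (-α)) (α * k) (-1) := by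
      have := hs.rpow_const (p := -α) (Or.inl (by norm_num))
      convert this using 1
      norm_num [k]
    have r2 : HasDerivAt (fun s : ℝ => ((1 - s) ^ (1 - α))⁻¹) ((1 - α) * (ν / 2)) (-1) := by
      have := hs.rpow_const (p := -(1 - α)) (Or.inl (by norm_num))
      have h2 := this.congr_of_eventuallyEq (f₁ := fun s : ℝ => ((1 - s) ^ (1 - α))⁻¹) (by
        filter_upwards [Iio_mem_nhds (show (-1:ℝ) < 0 by norm_num)] with s hs
        have hs' : s < 0 := hs
        rw [Real.rpow_neg (by linarith)])
      have hval : (-1:ℝ) * -(1 - α) * (1 - -1) ^ (-(1 - α) - 1) = (1 - α) * (ν / 2) := by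
        have : (1:ℝ) - (-1) = 2 := by norm_num
        rw [this, Real.rpow_sub_one (by norm_num), Real.rpow_neg (by norm_num)]
        simp only [ν]
        ring
      rw [hval] at h2
      exact h2
    have r3 : HasDerivAt (fun s : ℝ => V (((1 - s) ^ (1 - α))⁻¹ • x))
        (fderiv ℝ V (ν • x) (((1 - α) * (ν / 2)) • x)) (-1) := by
      have hp : (((1:ℝ) - (-1)) ^ (1 - α))⁻¹ = ν := by norm_num [ν]
      have := (hd ((((1:ℝ) - (-1)) ^ (1 - α))⁻¹ • x)).hasFDerivAt.comp_hasDerivAt (-1) (r2.smul_const x)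
      rw [hp] at this
      exact this
    have r4 := (r1.smul r3).congr_of_eventuallyEq (f₁ := fun s => v x s) (by
      filter_upwards [Iio_mem_nhds (show (-1:ℝ) < 0 by norm_num)] with s hs
      exact hv x s (le_of_lt hs))
    rw [r4.deriv, e1]
    have hp : (((1:ℝ) - (-1)) ^ (1 - α))⁻¹ = ν := by norm_num [ν]
    have hk2 : (2:ℝ) ^ (-α) = 2 * k := by
      simp only [k]
      rw [Real.rpow_sub_one (by norm_num)]
      ring
    rw [hp, show (1:ℝ) - (-1) = 2 by norm_num, hk2]
    simp only [G, map_add, map_smul, smul_add, smul_smul]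
    module
  have hcurlG : ∀ y : ℝ × ℝ, y.1 ≤ 0 → (fderiv ℝ G y (0,1)).1 = (fderiv ℝ G y (1,0)).2 := by
    have hsc : ContDiff ℝ 1 (fun x : ℝ × ℝ => k • G (ν • x)) :=
      (hGC.comp (contDiff_id.const_smul ν)).const_smul k
    have hA := curl_zero (fun x => k • G (ν • x)) hsc (fun y => -(p y (-1))) (by
      intro x hx
      have := heuler x hx.le (-1) (by norm_num)
      rw [hprof] at this
      rw [eq_neg_of_add_eq_zero_left this, fderiv_fun_neg]
      rfl)
    intro y hy
    have hA' := hA (ν⁻¹ • y) (by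
      simp only [Prod.smul_fst, smul_eq_mul]
      exact mul_nonpos_of_nonneg_of_nonpos (inv_pos.2 hν).le hy)
    have hGd : Differentiable ℝ G := hGC.differentiable (by norm_num)
    have hlin : HasFDerivAt (fun y : ℝ × ℝ => ν • y) (ν • ContinuousLinearMap.id ℝ (ℝ × ℝ)) (ν⁻¹ • y) :=
      (hasFDerivAt_id _).const_smul ν
    have hsp : HasFDerivAt (fun y => k • G (ν • y)) _ (ν⁻¹ • y) :=
      ((hGd (ν • ν⁻¹ • y)).hasFDerivAt.comp _ hlin).const_smul k
    rw [hsp.fderiv, smul_inv_smul₀ hν.ne'] at hA'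
    simp only [_root_.smul_apply, ContinuousLinearMap.comp_apply, ContinuousLinearMap.id_apply,
      map_smul, Prod.smul_fst, Prod.smul_snd, smul_eq_mul] at hA'
    exact mul_left_cancel₀ hν.ne' (mul_left_cancel₀ hk.ne' hA')
  have hW : ∀ y : ℝ × ℝ, y.1 ≤ 0 → (fderiv ℝ V y (0,1)).1 - (fderiv ℝ V y (1,0)).2 = 0 := by
    have hL0 : 0 ≤ L := (norm_nonneg _).trans (hL 0)
    have hlip : ∀ y, ‖V y - V 0‖ ≤ L * ‖y‖ := by
      intro y
      have := Convex.norm_image_sub_le_of_norm_fderiv_le (𝕜 := ℝ) (fun z _ => hd z) (fun z _ => hL z)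
        convex_univ (mem_univ 0) (mem_univ y)
      simpa using this
    refine max_pr _ ?_ (fun y => (1 - α) • y + V y) (1 + L + ‖V 0‖) M ?_ ?_ hMV ?_
    · exact (hC1.clm_apply contDiff_const).fst.sub (hC1.clm_apply contDiff_const).snd
    · intro y
      have h1 := norm_add_le ((1 - α) • y) (V y)
      rw [norm_smul, Real.norm_eq_abs, abs_of_pos (by linarith [hα.2])] at h1
      have h2 := hlip y
      have h3 := norm_le_norm_add_norm_sub' (V y) (V 0)
      nlinarith [norm_nonneg y, norm_nonneg (V 0), hα.1, mul_nonneg hα.1.le (norm_nonneg y),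
        mul_nonneg (norm_nonneg (V 0)) (norm_nonneg y)]
    · rintro ⟨a, c⟩ h
      simp only at h
      subst h
      simp [hbcV c]
    · intro y hy
      exact curl_comp α V hV y (hdivV y hy) (hcurlG y hy)
  have hfinal : ∀ y : ℝ × ℝ, y.1 ≤ 0 → V y = 0 := by
    intro y hy
    rw [liouville_half V hd C δ hδ hC hdivV hW hbcV y hy]
    ext
    · exact hbcV 0
    · have := hVodd 0
      have e : (((0 : ℝ × ℝ).1, -(0 : ℝ × ℝ).2) : ℝ × ℝ) = 0 := by ext <;> simp
      rw [e] at this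
      simp only [Prod.snd_zero]
      linarith
  intro x hx t ht
  rw [hv x t ht, hfinal _ ?_, smul_zero]
  simp only [Prod.smul_fst, smul_eq_mul]
  have : 0 < 1 - t := by linarith
  exact mul_nonpos_of_nonneg_of_nonpos (by positivity) hx
end

section
/- Let Θ : ℝ²₊ → ℝ be continuous on the half-plane {z₁ ≤ 0}, odd in z₂, and suppose that for every smooth compactly supported function f, ∫_{ℝ²₊} Θ²(z) ∂_{z₂} f(z) dz = 0. Then Θ ≡ 0. -/
open Set MeasureTheory

noncomputable def pd2 (f : ℝ × ℝ → ℝ) (z : ℝ × ℝ) : ℝ := fderiv ℝ f z (0, 1)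

lemma aux_prim (b : ℝ → ℝ) (hb : ContDiff ℝ (⊤ : ℕ∞) b) (hbc : HasCompactSupport b) (h : ℝ) :
    ∃ B : ℝ → ℝ, ContDiff ℝ (⊤ : ℕ∞) B ∧ HasCompactSupport B ∧
      ∀ t, HasDerivAt B (b t - b (t - h)) t := by
  have hP : ∀ t, HasDerivAt (fun t => ∫ s in (0:ℝ)..t, b s) (b t) t := fun t =>
    intervalIntegral.integral_hasDerivAt_right (hb.continuous.intervalIntegrable _ _)
      (hb.continuous.stronglyMeasurableAtFilter _ _) hb.continuous.continuousAt
  have hB : ∀ t, HasDerivAt (fun t => (∫ s in (0:ℝ)..t, b s) - ∫ s in (0:ℝ)..(t-h), b s)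
      (b t - b (t - h)) t := fun t => (hP t).sub ((hP (t - h)).comp_sub_const t h)
  refine ⟨_, ?_, ?_, hB⟩
  · rw [contDiff_infty_iff_deriv]
    refine ⟨fun t => (hB t).differentiableAt, ?_⟩
    rw [funext fun t => (hB t).deriv]
    exact hb.sub (hb.comp (contDiff_id.sub contDiff_const))
  · obtain ⟨R, hR⟩ := hbc.isCompact.isBounded.subset_closedBall (0:ℝ)
    have hz : ∀ s, R < |s| → b s = 0 := by
      intro s hs
      by_contra hne
      have := hR (subset_tsupport b hne)
      rw [Metric.mem_closedBall, Real.dist_eq, sub_zero] at this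
      linarith
    refine HasCompactSupport.of_support_subset_isCompact
      (isCompact_closedBall (0:ℝ) (|R| + |h|)) ?_
    intro t ht
    rw [Metric.mem_closedBall, Real.dist_eq, sub_zero]
    by_contra hlt
    push Not at hlt
    apply ht
    show (∫ s in (0:ℝ)..t, b s) - ∫ s in (0:ℝ)..(t-h), b s = 0
    rw [intervalIntegral.integral_interval_sub_left (hb.continuous.intervalIntegrable _ _)
      (hb.continuous.intervalIntegrable _ _)]
    apply intervalIntegral.integral_zero_ae
    refine Filter.Eventually.of_forall fun s hs => hz s ?_
    have h1 := le_abs_self R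
    have h2 := le_abs_self h
    have h3 := neg_abs_le h
    have h4 := abs_nonneg R
    have hs' := Set.uIoc_subset_uIcc hs
    rw [Set.mem_uIcc] at hs'
    rcases abs_cases t with ⟨e, _⟩ | ⟨e, _⟩
    · refine lt_of_lt_of_le ?_ (le_abs_self s)
      rcases hs' with h | h <;> linarith
    · refine lt_of_lt_of_le ?_ (neg_le_abs s)
      rcases hs' with h | h <;> linarith

lemma aux_interior
    (Θ : ℝ × ℝ → ℝ)
    (hΘ_cont : ContinuousOn Θ {z : ℝ × ℝ | z.1 ≤ 0})
    (hodd : ∀ z : ℝ × ℝ, z.1 ≤ 0 → Θ (z.1, -z.2) = -Θ z)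
    (hint : ∀ f : ℝ × ℝ → ℝ, ContDiff ℝ (⊤ : ℕ∞) f → HasCompactSupport f →
      ∫ z in {z : ℝ × ℝ | z.1 ≤ 0}, Θ z ^ 2 * pd2 f z = 0)
    (x y : ℝ) (hx : x < 0) : Θ (x, y) = 0 := by
  by_contra hne
  have h0 : Θ (x, 0) = 0 := by
    have := hodd (x, 0) hx.le
    simp only [neg_zero] at this
    linarith
  obtain ⟨T, hT⟩ : ∃ T : ℝ × ℝ → ℝ, T = fun z => Θ (min z.1 0, z.2) ^ 2 := ⟨_, rfl⟩
  have hTc : Continuous T := by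
    rw [hT]
    have hm : Continuous (fun z : ℝ × ℝ => ((min z.1 0, z.2) : ℝ × ℝ)) := by fun_prop
    exact (hΘ_cont.comp_continuous hm fun z => min_le_right z.1 0).pow 2
  have hTe : ∀ z : ℝ × ℝ, z.1 ≤ 0 → T z = Θ z ^ 2 := fun z hz => by
    simp [hT, min_eq_left hz]
  let h : ℝ := -y
  let G : ℝ × ℝ → ℝ := fun z => T z - T (z + (0, h))
  have hGc : Continuous G := by fun_prop
  have hG : 0 < G (x, y) := by
    have e : ((x, y) + (0, h) : ℝ × ℝ) = (x, 0) := by simp [h]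
    simp only [G, e]
    rw [hTe _ hx.le, hTe _ hx.le, h0]
    have : 0 < Θ (x, y) ^ 2 := by positivity
    simpa using this
  obtain ⟨r, hr, hrG⟩ := Metric.isOpen_iff.1 (isOpen_lt continuous_const hGc) (x, y) hG
  obtain ⟨ρ, hρ, hρr, hρx⟩ : ∃ ρ : ℝ, 0 < ρ ∧ ρ ≤ r ∧ ρ ≤ -x :=
    ⟨min r (-x), lt_min hr (by linarith), min_le_left _ _, min_le_right _ _⟩
  let a : ContDiffBump x := ⟨ρ / 2, ρ, by linarith, by linarith⟩
  let b : ContDiffBump y := ⟨ρ / 2, ρ, by linarith, by linarith⟩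
  have ha : ∀ s, ρ ≤ dist s x → a s = 0 := fun s hs => a.zero_of_le_dist hs
  have hb : ∀ s, ρ ≤ dist s y → b s = 0 := fun s hs => b.zero_of_le_dist hs
  have ha0 : ∀ s, 0 < s → a s = 0 := fun s hs => ha s (by
    rw [Real.dist_eq]; exact le_trans (by linarith) (le_abs_self _))
  obtain ⟨B, hB, hBc, hBd⟩ := aux_prim b b.contDiff b.hasCompactSupport h
  have cs : ∀ c : ℝ → ℝ, HasCompactSupport c →
      HasCompactSupport (fun z : ℝ × ℝ => a z.1 * c z.2) := by
    intro c hc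
    refine HasCompactSupport.of_support_subset_isCompact
      (a.hasCompactSupport.isCompact.prod hc.isCompact) ?_
    intro z hz
    have hz' : a z.1 * c z.2 ≠ 0 := hz
    exact ⟨subset_tsupport _ (left_ne_zero_of_mul hz'),
      subset_tsupport _ (right_ne_zero_of_mul hz')⟩
  have key := hint (fun z => a z.1 * B z.2)
    ((a.contDiff.comp contDiff_fst).mul (hB.comp contDiff_snd)) (cs B hBc)
  have hpd : ∀ z : ℝ × ℝ, pd2 (fun z => a z.1 * B z.2) z = a z.1 * (b z.2 - b (z.2 - h)) := by
    intro z
    have hA : HasFDerivAt (fun z : ℝ × ℝ => a z.1)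
        ((fderiv ℝ a z.1).comp (ContinuousLinearMap.fst ℝ ℝ ℝ)) z :=
      ((a.contDiff (n := 1)).differentiable (by simp) z.1).hasFDerivAt.comp z hasFDerivAt_fst
    have hB' := (hBd z.2).hasFDerivAt.comp z (hasFDerivAt_snd (𝕜 := ℝ) (E := ℝ) (F := ℝ) (p := z))
    have := (hA.mul hB').fderiv
    unfold pd2
    erw [this]
    simp
  have bc : Continuous b := b.continuous
  have ac : Continuous a := a.continuous
  have e1 : ∫ z in {z : ℝ × ℝ | z.1 ≤ 0}, Θ z ^ 2 * pd2 (fun z => a z.1 * B z.2) z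
      = ∫ z : ℝ × ℝ, T z * (a z.1 * (b z.2 - b (z.2 - h))) := by
    refine Eq.trans ?_
      (setIntegral_eq_integral_of_forall_compl_eq_zero (s := {z : ℝ × ℝ | z.1 ≤ 0}) ?_)
    · refine setIntegral_congr_fun (measurableSet_le measurable_fst measurable_const) ?_
      intro z hz
      simp only [hpd, hTe z hz]
    · intro z hz
      rw [ha0 z.1 (not_le.1 hz)]; simp
  rw [e1] at key
  have i1 : Integrable (fun z : ℝ × ℝ => T z * (a z.1 * b z.2)) :=
    (by fun_prop : Continuous _).integrable_of_hasCompactSupport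
      ((cs b b.hasCompactSupport).mul_left)
  have i3 : Integrable (fun z : ℝ × ℝ => T (z + (0, h)) * (a z.1 * b z.2)) :=
    (by fun_prop : Continuous _).integrable_of_hasCompactSupport
      ((cs b b.hasCompactSupport).mul_left)
  have tr : ∀ z : ℝ × ℝ, (fun z : ℝ × ℝ => T z * (a z.1 * b (z.2 - h))) (z + (0, h))
      = T (z + (0, h)) * (a z.1 * b z.2) := by
    intro z; simp
  have i2 : Integrable (fun z : ℝ × ℝ => T z * (a z.1 * b (z.2 - h))) := by
    have := i3.comp_sub_right ((0, h) : ℝ × ℝ)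
    simpa using this
  have e2 : ∫ z : ℝ × ℝ, T z * (a z.1 * b (z.2 - h))
      = ∫ z : ℝ × ℝ, T (z + (0, h)) * (a z.1 * b z.2) := by
    rw [← integral_add_right_eq_self _ ((0, h) : ℝ × ℝ)]
    exact integral_congr_ae (Filter.Eventually.of_forall tr)
  have e3 : ∫ z : ℝ × ℝ, G z * (a z.1 * b z.2) = 0 := by
    have : ∀ z : ℝ × ℝ, G z * (a z.1 * b z.2)
      = T z * (a z.1 * b z.2) - T (z + (0, h)) * (a z.1 * b z.2) := fun z => by
        simp only [G]; ring
    simp only [this]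
    rw [integral_sub i1 i3, ← e2, ← integral_sub i1 i2, ← key]
    congr 1; ext z; ring
  have pos : 0 < ∫ z : ℝ × ℝ, G z * (a z.1 * b z.2) := by
    refine Continuous.integral_pos_of_hasCompactSupport_nonneg_nonzero (x := (x, y))
      (by fun_prop) ((cs b b.hasCompactSupport).mul_left) ?_ ?_
    · intro z
      show 0 ≤ G z * (a z.1 * b z.2)
      by_cases h1 : ρ ≤ dist z.1 x
      · simp [ha _ h1]
      by_cases h2 : ρ ≤ dist z.2 y
      · simp [hb _ h2]
      have hz : z ∈ Metric.ball ((x, y) : ℝ × ℝ) r := by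
        rw [Metric.mem_ball, Prod.dist_eq]
        exact max_lt (by linarith) (by linarith)
      have h3 : 0 < G z := hrG hz
      exact mul_nonneg h3.le (mul_nonneg a.nonneg b.nonneg)
    · have h1 : a x = 1 := a.one_of_mem_closedBall (by simp; linarith [a.rIn_pos])
      have h2 : b y = 1 := b.one_of_mem_closedBall (by simp; linarith [b.rIn_pos])
      simp only [h1, h2]
      simpa using hG.ne'
  linarith

/-- If `Θ` is continuous on the half-plane `{z₁ ≤ 0}`, odd in `z₂`, and
`∫_{z₁ ≤ 0} Θ² ∂₂f = 0` for every smooth compactly supported `f`, then `Θ ≡ 0`. -/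
theorem stmt_19
    (Θ : ℝ × ℝ → ℝ)
    (hΘ_cont : ContinuousOn Θ {z : ℝ × ℝ | z.1 ≤ 0})
    -- Θ is odd in z₂
    (hodd : ∀ z : ℝ × ℝ, z.1 ≤ 0 → Θ (z.1, -z.2) = -Θ z)
    -- the distributional identity
    (hint : ∀ f : ℝ × ℝ → ℝ, ContDiff ℝ (⊤ : ℕ∞) f → HasCompactSupport f →
      ∫ z in {z : ℝ × ℝ | z.1 ≤ 0}, Θ z ^ 2 * pd2 f z = 0) :
    ∀ z : ℝ × ℝ, z.1 ≤ 0 → Θ z = 0 := by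
  rintro ⟨x, y⟩ hx
  rcases lt_or_eq_of_le hx with hx | hx
  · exact aux_interior Θ hΘ_cont hodd hint x y hx
  · simp only at hx
    subst hx
    have hc : ContinuousOn (fun s : ℝ => Θ (s, y)) (Iic 0) :=
      hΘ_cont.comp (by fun_prop) fun s hs => hs
    have h1 : Filter.Tendsto (fun s : ℝ => Θ (s, y)) (nhdsWithin 0 (Iio 0)) (nhds (Θ (0, y))) :=
      (hc 0 (by simp)).mono_left (nhdsWithin_mono _ Iio_subset_Iic_self)
    have h2 : Filter.Tendsto (fun s : ℝ => Θ (s, y)) (nhdsWithin 0 (Iio 0)) (nhds 0) := by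
      refine tendsto_const_nhds.congr' ?_
      filter_upwards [self_mem_nhdsWithin] with s hs
      exact (aux_interior Θ hΘ_cont hodd hint s y hs).symm
    exact tendsto_nhds_unique h1 h2
end
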